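/- Every potential of a graphical transformed potential game with graph G is a Gibbs potential with respect to G: if Ψ : A → ℝ is an f-transformed potential of a graphical game with graph G, then there exist functions φ_C : A_C → ℝ, one for each maximal clique C of G, such that Ψ(x) = Σ_{C∈𝒞} φ_C(x_C) for all x ∈ A, where 𝒞 is the set of maximal cliques of G. -/

import Mathlib

/-- `C` is a maximal clique of the simple graph `G`. -/
def IsMaxClique {V : Type*} (G : SimpleGraph V) (C : Finset V) : Prop :=
  G.IsClique (C : Set V) ∧ ∀ D : Finset V, G.IsClique (D : Set V) → C ⊆ D → C = D

/-- A real-valued function of a joint configuration depends only on the coordinates in `C`. -/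
def LocalOn {V : Type*} {A : V → Type*} (C : Finset V) (φ : (∀ i, A i) → ℝ) : Prop :=
  ∀ x y : ∀ i, A i, (∀ j ∈ C, x j = y j) → φ x = φ y

/-- The Möbius transform of a set function `h`: the alternating sum of `h` over the subsets
of `D`. -/
def moebiusTransform {V : Type*} (h : Finset V → ℝ) (D : Finset V) : ℝ :=
  ∑ S ∈ D.powerset, (-1) ^ (D.card + S.card) * h S

theorem moebiusTransform_insert {V : Type*} [DecidableEq V] (h : Finset V → ℝ) {D : Finset V}
    {i : V} (hi : i ∉ D) :
    moebiusTransform h (insert i D) = moebiusTransform (fun S => h (insert i S) - h S) D := by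
  unfold moebiusTransform
  rw [Finset.sum_powerset_insert hi, ← Finset.sum_add_distrib]
  refine Finset.sum_congr rfl fun S hS => ?_
  have hiS : i ∉ S := fun hmem => hi (Finset.mem_powerset.mp hS hmem)
  rw [Finset.card_insert_of_notMem hi, Finset.card_insert_of_notMem hiS]
  ring

theorem sum_powerset_moebiusTransform {V : Type*} [DecidableEq V] (h : Finset V → ℝ)
    (T : Finset V) : ∑ D ∈ T.powerset, moebiusTransform h D = h T := by
  induction T using Finset.induction_on generalizing h with
  | empty => simp [moebiusTransform]
  | insert i T hi ih =>
    have hsum : ∑ D ∈ T.powerset, moebiusTransform h (insert i D) =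
        ∑ D ∈ T.powerset, moebiusTransform (fun S => h (insert i S) - h S) D :=
      Finset.sum_congr rfl fun D hD =>
        moebiusTransform_insert h fun hmem => hi (Finset.mem_powerset.mp hD hmem)
    rw [Finset.sum_powerset_insert hi, hsum, ih, ih]
    ring

/-- Every clique of a finite graph is contained in a maximal clique. -/
theorem exists_isMaxClique_superset {V : Type*} [Finite V] {G : SimpleGraph V} {D : Finset V}
    (hD : G.IsClique (D : Set V)) : ∃ C, D ⊆ C ∧ IsMaxClique G C := by
  obtain ⟨C, hDC, hC⟩ :=
    Set.Finite.exists_le_maximal (Set.toFinite {C : Finset V | G.IsClique (C : Set V)}) hD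
  exact ⟨C, hDC, hC.prop, fun E hE hCE => hC.eq_of_le hE hCE⟩

/-- If the effect on `Ψ` of changing coordinate `i` depends only on the neighbors of `i`, then
`Ψ` is a Gibbs potential. -/
theorem exists_gibbs_decomposition {V : Type*} [Fintype V] [DecidableEq V] (G : SimpleGraph V)
    {A : V → Type*} [∀ i, Nonempty (A i)] (Ψ : (∀ i, A i) → ℝ)
    (hΨ : ∀ (i : V) (x y : ∀ j, A j) (a a' : A i), (∀ j, G.Adj i j → x j = y j) →
      Ψ (Function.update x i a) - Ψ (Function.update x i a') =
        Ψ (Function.update y i a) - Ψ (Function.update y i a')) :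
    ∃ φ : Finset V → ((∀ i, A i) → ℝ),
      (∀ C : Finset V, ¬ IsMaxClique G C → φ C = 0) ∧
      (∀ C : Finset V, LocalOn C (φ C)) ∧
      (∀ x, Ψ x = ∑ C : Finset V, φ C x) := by
  classical
  let o : ∀ i, A i := fun i => Classical.arbitrary (A i)
  let ψ : Finset V → (∀ i, A i) → ℝ := fun D x =>
    moebiusTransform (fun S => Ψ (S.piecewise x o)) D
  have ψ_local (D : Finset V) : LocalOn D (ψ D) := by
    intro x y hxy
    refine Finset.sum_congr rfl fun S hS => ?_
    have hpw : S.piecewise x o = S.piecewise y o :=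
      S.piecewise_congr (fun j hj => hxy j (Finset.mem_powerset.mp hS hj)) fun _ _ => rfl
    simp only [hpw]
  have ψ_eq_zero (D : Finset V) (hD : ¬ G.IsClique (D : Set V)) (x : ∀ i, A i) : ψ D x = 0 := by
    obtain ⟨i, hi, j, hj, hij, hadj⟩ : ∃ i ∈ D, ∃ j ∈ D, i ≠ j ∧ ¬ G.Adj i j := by
      simpa [SimpleGraph.IsClique, Set.Pairwise] using hD
    have hjD : j ∈ D.erase i := Finset.mem_erase.mpr ⟨hij.symm, hj⟩
    have hiT : i ∉ insert j ((D.erase i).erase j) := by simp [hij]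
    change moebiusTransform _ D = 0
    rw [← Finset.insert_erase hi, ← Finset.insert_erase hjD, moebiusTransform_insert _ hiT,
      moebiusTransform_insert _ (Finset.notMem_erase _ _)]
    refine Finset.sum_eq_zero fun S _ => mul_eq_zero_of_right _ ?_
    simp only [Finset.piecewise_insert]
    have key := hΨ i (Function.update (S.piecewise x o) j (x j)) (S.piecewise x o) (x i)
      (S.piecewise x o i) fun k hk =>
        Function.update_of_ne (by rintro rfl; exact hadj hk) _ _
    rw [Function.update_comm hij.symm _ (S.piecewise x o i), Function.update_eq_self] at key
    exact sub_eq_zero.mpr key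
  have hex (D : Finset V) :
      ∃ C, G.IsClique (D : Set V) → D ⊆ C ∧ IsMaxClique G C := by
    by_cases hD : G.IsClique (D : Set V)
    · obtain ⟨C, hC⟩ := exists_isMaxClique_superset hD
      exact ⟨C, fun _ => hC⟩
    · exact ⟨D, fun h => absurd h hD⟩
  choose m hm using hex
  refine ⟨fun C x => ∑ D with m D = C, ψ D x, ?_, ?_, ?_⟩
  · intro C hC
    funext x
    refine Finset.sum_eq_zero fun D hD => ψ_eq_zero D (fun hcl => hC ?_) x
    exact (Finset.mem_filter.mp hD).2 ▸ (hm D hcl).2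
  · intro C x y hxy
    refine Finset.sum_congr rfl fun D hD => ?_
    by_cases hcl : G.IsClique (D : Set V)
    · exact ψ_local D x y fun j hj => hxy j ((Finset.mem_filter.mp hD).2 ▸ (hm D hcl).1 hj)
    · rw [ψ_eq_zero D hcl, ψ_eq_zero D hcl]
  · intro x
    rw [Finset.sum_fiberwise, ← Finset.powerset_univ, sum_powerset_moebiusTransform,
      Finset.piecewise_univ]

/-- Every potential of a graphical `f`-transformed potential game with graph `G` is a Gibbs
potential with respect to `G`: it decomposes as a sum of local potentials, one for each
maximal clique of `G`.  Here `M i` is the payoff of player `i`, which depends only on the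
actions in the closed neighborhood of `i`; `f i` is a (conditional) preference-order-preserving
transform, i.e. strictly increasing in its real argument and depending on the other players'
actions only through the neighbors of `i`; and `Ψ` is an `f`-transformed potential. -/
theorem graphical_transformed_potential_is_gibbs_potential
    {V : Type*} [Fintype V] [DecidableEq V] [Nonempty V] (G : SimpleGraph V)
    {A : V → Type*} [∀ i, Fintype (A i)] [∀ i, Nonempty (A i)]
    (M : V → (∀ i, A i) → ℝ)
    (hMlocal : ∀ (i : V) (x y : ∀ j, A j), x i = y i →
      (∀ j, G.Adj i j → x j = y j) → M i x = M i y)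
    (f : V → ℝ → (∀ i, A i) → ℝ)
    (hflocal : ∀ (i : V) (v : ℝ) (x y : ∀ j, A j),
      (∀ j, G.Adj i j → x j = y j) → f i v x = f i v y)
    (hfmono : ∀ (i : V) (x : ∀ j, A j), StrictMono (fun v => f i v x))
    (Ψ : (∀ i, A i) → ℝ)
    (hpot : ∀ (i : V) (x : ∀ j, A j) (a a' : A i),
      M i (Function.update x i a) - M i (Function.update x i a') =
        f i (Ψ (Function.update x i a) - Ψ (Function.update x i a')) x) :
    ∃ φ : Finset V → ((∀ i, A i) → ℝ),
      (∀ C : Finset V, ¬ IsMaxClique G C → φ C = 0) ∧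
      (∀ C : Finset V, LocalOn C (φ C)) ∧
      (∀ x, Ψ x = ∑ C : Finset V, φ C x) := by
  refine exists_gibbs_decomposition G Ψ fun i x y a a' hxy => (hfmono i x).injective ?_
  have hM (b : A i) : M i (Function.update x i b) = M i (Function.update y i b) :=
    hMlocal i _ _ (by simp) fun j hj => by
      rw [Function.update_of_ne hj.ne', Function.update_of_ne hj.ne', hxy j hj]
  change f i _ x = f i _ x
  rw [← hpot, hM, hM, hpot, hflocal i _ x y hxy]
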